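/- arXiv:math/0612538 — 3 statements merged into one kernel-verified Lean document; each statement's English description precedes it below -/
import Mathlib

section
/- Let $C_{12}'\subseteq\mathbb{R}^6$ be the cone generated by the twelve vectors $z_1=(0,1,0,0,0,0)$, $z_2=(0,0,1,0,0,0)$, $z_3=(0,0,0,1,0,0)$, $z_4=(0,0,0,0,1,0)$, $z_5=(0,0,0,0,0,1)$, $z_6=(1,0,2,1,1,2)$, $z_7=(1,2,0,2,1,1)$, $z_8=(1,1,2,0,2,1)$, $z_9=(1,1,1,2,0,2)$, $z_{10}=(1,2,1,1,2,0)$, $z_{11}''=(0,-1,2,-1,-1,2)$, $z_{12}''=(1,0,3,0,0,3)$. Then $C_{12}'$ is a pointed full-dimensional rational cone whose Hilbert basis is exactly $\{z_1,\dots,z_{10},z_{11}'',z_{12}''\}$. -/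
/-- The real vector corresponding to an integer vector. -/
def toR {d : ℕ} (x : Fin d → ℤ) : Fin d → ℝ := fun i => (x i : ℝ)

/-- The cone generated by a finite family of integer vectors. -/
def coneFin {d n : ℕ} (v : Fin n → (Fin d → ℤ)) : Set (Fin d → ℝ) :=
  { y | ∃ a : Fin n → ℝ, (∀ i, 0 ≤ a i) ∧ y = ∑ i, a i • toR (v i) }

/-- The cone generated by a set of integer vectors (nonnegative real combinations
of finitely many of its elements). -/
def coneSet {d : ℕ} (B : Set (Fin d → ℤ)) : Set (Fin d → ℝ) :=
  { y | ∃ (n : ℕ) (v : Fin n → (Fin d → ℤ)) (a : Fin n → ℝ),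
      (∀ i, v i ∈ B) ∧ (∀ i, 0 ≤ a i) ∧ y = ∑ i, a i • toR (v i) }

/-- A finitely generated rational cone. -/
def IsRatCone {d : ℕ} (C : Set (Fin d → ℝ)) : Prop :=
  ∃ B : Finset (Fin d → ℤ), C = coneSet (B : Set (Fin d → ℤ))

/-- A pointed cone: `x, -x ∈ C` implies `x = 0`. -/
def PointedSet {d : ℕ} (C : Set (Fin d → ℝ)) : Prop :=
  ∀ x ∈ C, -x ∈ C → x = 0

/-- A full-dimensional subset of `ℝ^d`. -/
def FullDim {d : ℕ} (C : Set (Fin d → ℝ)) : Prop :=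
  Submodule.span ℝ C = ⊤

/-- The Hilbert basis of the monoid `C ∩ ℤ^d`: the nonzero lattice points of `C`
admitting no decomposition into two nonzero lattice points of `C`. -/
def hilbC {d : ℕ} (C : Set (Fin d → ℝ)) : Set (Fin d → ℤ) :=
  { z | toR z ∈ C ∧ z ≠ 0 ∧
    ¬∃ u v : Fin d → ℤ, toR u ∈ C ∧ toR v ∈ C ∧ u ≠ 0 ∧ v ≠ 0 ∧ z = u + v }

/-- The twelve generators of the cone `C₁₂'`: the Hilbert basis of `C₁₀`
together with `z₁₁'' = (0,-1,2,-1,-1,2)` and `z₁₂'' = (1,0,3,0,0,3)`. -/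
def w : Fin 12 → (Fin 6 → ℤ) :=
  ![![0, 1, 0, 0, 0, 0],
    ![0, 0, 1, 0, 0, 0],
    ![0, 0, 0, 1, 0, 0],
    ![0, 0, 0, 0, 1, 0],
    ![0, 0, 0, 0, 0, 1],
    ![1, 0, 2, 1, 1, 2],
    ![1, 2, 0, 2, 1, 1],
    ![1, 1, 2, 0, 2, 1],
    ![1, 1, 1, 2, 0, 2],
    ![1, 2, 1, 1, 2, 0],
    ![0, -1, 2, -1, -1, 2],
    ![1, 0, 3, 0, 0, 3]]

/-! ### Covering a box by upward closed sets -/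

/-! The kernel has to evaluate the following functions, so they are written with recursors,
which reduce faster than compiled pattern matching. -/

/-- The head of a list, or `0`. -/
def listHead (l : List ℕ) : ℕ := List.rec 0 (fun a _ _ => a) l

/-- The tail of a list. -/
def listTail (l : List ℕ) : List ℕ := List.rec [] (fun _ t _ => t) l

/-- The scalar product of two lists of naturals, over the length of the second. -/
def listDot : List ℕ → List ℕ → ℕ
  | _, [] => 0
  | f, y :: ys => listHead f * y + listDot (listTail f) ys

/-- `ListDominates p y`: the entries of `p` are at most those of `y`. -/
def ListDominates : List ℕ → List ℕ → Prop
  | _, [] => True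
  | p, y :: ys => listHead p ≤ y ∧ ListDominates (listTail p) ys

/-- Substitute the value `hi` for the first variable in inequalities `d ≤ f ⬝ y`, dropping those
that have become trivial. -/
def substIneqs (hi : ℕ) (fs : List (ℕ × List ℕ)) : List (ℕ × List ℕ) :=
  List.rec [] (fun q _ r => Bool.rec r
    ((Nat.sub q.1 (Nat.mul (listHead q.2) hi), listTail q.2) :: r)
    (Nat.blt (Nat.mul (listHead q.2) hi) q.1)) fs

/-- The tails of those points whose first entry is at most `lo`. -/
def slicePoints (lo : ℕ) (ps : List (List ℕ)) : List (List ℕ) :=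
  List.rec [] (fun p _ r => Bool.rec r (listTail p :: r) (Nat.ble (listHead p) lo)) ps

/-- The least first entry of a point of `ps` exceeding `lo`, or `m` if that is smaller. -/
def nextBreak (lo : ℕ) (ps : List (List ℕ)) (m : ℕ) : ℕ :=
  List.rec (fun m => m) (fun p _ r m => Bool.rec (r m)
    (Bool.rec (r m) (r (listHead p)) (Nat.blt (listHead p) m)) (Nat.blt lo (listHead p))) ps m

/-- The least first entry of a point of `ps`, or `m` if that is smaller. -/
def minHead (ps : List (List ℕ)) (m : ℕ) : ℕ :=
  List.rec (fun m => m) (fun p _ r m => Bool.rec (r m) (r (listHead p))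
    (Nat.blt (listHead p) m)) ps m

/-- Some inequality `d ≤ f ⬝ y` in one variable fails for `y = hi`. -/
def someIneqFails (hi : ℕ) (fs : List (ℕ × List ℕ)) : Bool :=
  List.rec false (fun q _ r => Bool.rec r true (Nat.blt (Nat.mul (listHead q.2) hi) q.1)) fs

/-- `f n`, where the kernel reduces `n` to a literal first. -/
def withLiteral (n : ℕ) (f : ℕ → Bool) : Bool := Nat.rec (f 0) (fun k _ => f (Nat.succ k)) n

/-- Run `check` on all slabs `lo ≤ y₀ < nextBreak lo ps (B + 1)` of the box; the number `k`
bounds the number of slabs. -/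
def sweepSlabs (B : ℕ) (check : List (ℕ × List ℕ) → List (List ℕ) → Bool)
    (fs : List (ℕ × List ℕ)) (ps : List (List ℕ)) (k lo : ℕ) : Bool :=
  Nat.rec (fun _ => false) (fun _ r lo => Bool.rec
    (withLiteral (nextBreak lo ps (B + 1)) fun nx => Bool.rec false (r nx)
      (withLiteral (Nat.pred nx) fun hi => check (substIneqs hi fs) (slicePoints lo ps)))
    true (Nat.blt B lo)) k lo

/-- A test that each `y ∈ [0, B]^(n+1)` satisfying the inequalities `fs` dominates a point
of `ps`. -/
def coverTest (B n : ℕ) : List (ℕ × List ℕ) → List (List ℕ) → Bool :=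
  Nat.rec (fun fs ps => withLiteral (minHead ps (B + 1)) fun m =>
      Bool.rec (someIneqFails (Nat.pred m) fs) true (Nat.beq m 0))
    (fun _ r fs ps => sweepSlabs B r fs ps (B + 2) 0) n

lemma boolRec_eq_cond {α : Type*} (x y : α) (b : Bool) :
    (Bool.rec y x b : α) = cond b x y := by
  cases b <;> rfl

lemma withLiteral_eq (n : ℕ) (f : ℕ → Bool) : withLiteral n f = f n := by
  cases n <;> rfl

lemma substIneqs_cons (hi : ℕ) (q : ℕ × List ℕ) (fs : List (ℕ × List ℕ)) :
    substIneqs hi (q :: fs) = cond (Nat.blt (listHead q.2 * hi) q.1)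
      ((q.1 - listHead q.2 * hi, listTail q.2) :: substIneqs hi fs) (substIneqs hi fs) :=
  boolRec_eq_cond _ _ _

lemma slicePoints_cons (lo : ℕ) (p : List ℕ) (ps : List (List ℕ)) :
    slicePoints lo (p :: ps) =
      cond (Nat.ble (listHead p) lo) (listTail p :: slicePoints lo ps) (slicePoints lo ps) :=
  boolRec_eq_cond _ _ _

lemma minHead_cons (p : List ℕ) (ps : List (List ℕ)) (m : ℕ) :
    minHead (p :: ps) m =
      cond (Nat.blt (listHead p) m) (minHead ps (listHead p)) (minHead ps m) :=
  boolRec_eq_cond _ _ _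

lemma someIneqFails_cons (hi : ℕ) (q : ℕ × List ℕ) (fs : List (ℕ × List ℕ)) :
    someIneqFails hi (q :: fs) =
      cond (Nat.blt (listHead q.2 * hi) q.1) true (someIneqFails hi fs) :=
  boolRec_eq_cond _ _ _

lemma sweepSlabs_succ (B : ℕ) (check : List (ℕ × List ℕ) → List (List ℕ) → Bool)
    (fs : List (ℕ × List ℕ)) (ps : List (List ℕ)) (k lo : ℕ) :
    sweepSlabs B check fs ps (k + 1) lo = (Nat.blt B lo ||
      (check (substIneqs (nextBreak lo ps (B + 1) - 1) fs) (slicePoints lo ps) &&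
        sweepSlabs B check fs ps k (nextBreak lo ps (B + 1)))) := by
  rw [show sweepSlabs B check fs ps (k + 1) lo = Bool.rec
    (withLiteral (nextBreak lo ps (B + 1)) fun nx => Bool.rec false (sweepSlabs B check fs ps k nx)
      (withLiteral (Nat.pred nx) fun hi => check (substIneqs hi fs) (slicePoints lo ps)))
    true (Nat.blt B lo) from rfl]
  simp only [withLiteral_eq, boolRec_eq_cond, Nat.pred_eq_sub_one]
  cases Nat.blt B lo <;> simp

lemma coverTest_zero (B : ℕ) (fs : List (ℕ × List ℕ)) (ps : List (List ℕ)) :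
    coverTest B 0 fs ps = (Nat.beq (minHead ps (B + 1)) 0 ||
      someIneqFails (minHead ps (B + 1) - 1) fs) := by
  rw [show coverTest B 0 fs ps = withLiteral (minHead ps (B + 1)) fun m =>
    Bool.rec (someIneqFails (Nat.pred m) fs) true (Nat.beq m 0) from rfl, withLiteral_eq,
    boolRec_eq_cond]
  cases Nat.beq (minHead ps (B + 1)) 0 <;> rfl

lemma coverTest_succ (B n : ℕ) (fs : List (ℕ × List ℕ)) (ps : List (List ℕ)) :
    coverTest B (n + 1) fs ps = sweepSlabs B (coverTest B n) fs ps (B + 2) 0 := rfl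

lemma exists_listHead_le_of_minHead_le {y m : ℕ} {ps : List (List ℕ)}
    (h : minHead ps m ≤ y) : m ≤ y ∨ ∃ p ∈ ps, listHead p ≤ y := by
  induction ps generalizing m with
  | nil => exact Or.inl h
  | cons p ps ih =>
    rw [minHead_cons] at h
    cases hb : Nat.blt (listHead p) m <;> rw [hb] at h <;> rcases ih h with h | ⟨q, hq, hqy⟩
    · exact Or.inl h
    · exact Or.inr ⟨q, by simp [hq], hqy⟩
    · exact Or.inr ⟨p, by simp, h⟩
    · exact Or.inr ⟨q, by simp [hq], hqy⟩

lemma exists_lt_of_someIneqFails {hi : ℕ} {fs : List (ℕ × List ℕ)}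
    (h : someIneqFails hi fs = true) : ∃ q ∈ fs, listHead q.2 * hi < q.1 := by
  induction fs with
  | nil => exact absurd h Bool.false_ne_true
  | cons q fs ih =>
    rw [someIneqFails_cons] at h
    cases hb : Nat.blt (listHead q.2 * hi) q.1 <;> rw [hb] at h
    · obtain ⟨r, hr, hlt⟩ := ih h
      exact ⟨r, by simp [hr], hlt⟩
    · exact ⟨q, by simp, Nat.le_of_ble_eq_true hb⟩

lemma substIneqs_sound {y hi : ℕ} (hy : y ≤ hi) {ys : List ℕ} {fs : List (ℕ × List ℕ)}
    (h : ∀ q ∈ fs, q.1 ≤ listDot q.2 (y :: ys)) :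
    ∀ q ∈ substIneqs hi fs, q.1 ≤ listDot q.2 ys := by
  induction fs with
  | nil => exact fun q hq => absurd hq (List.not_mem_nil)
  | cons r fs ih =>
    have ih' := ih fun q hq => h q (List.mem_cons_of_mem _ hq)
    rw [substIneqs_cons]
    cases Nat.blt (listHead r.2 * hi) r.1
    · exact ih'
    · refine List.forall_mem_cons.2 ⟨?_, ih'⟩
      have h₁ := h r List.mem_cons_self
      have h₂ : listHead r.2 * y ≤ listHead r.2 * hi := Nat.mul_le_mul_left _ hy
      simp only [listDot] at h₁ ⊢
      omega

lemma exists_dominates_of_slicePoints {y lo : ℕ} (hy : lo ≤ y) {ys : List ℕ}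
    {ps : List (List ℕ)} (h : ∃ p ∈ slicePoints lo ps, ListDominates p ys) :
    ∃ p ∈ ps, ListDominates p (y :: ys) := by
  induction ps with
  | nil => exact absurd h (by rintro ⟨p, hp, -⟩; exact List.not_mem_nil hp)
  | cons r ps ih =>
    obtain ⟨p, hp, hpy⟩ := h
    suffices h' : (p = listTail r ∧ listHead r ≤ lo) ∨ p ∈ slicePoints lo ps by
      rcases h' with ⟨rfl, hr⟩ | h'
      · exact ⟨r, List.mem_cons_self, hr.trans hy, hpy⟩
      · obtain ⟨q, hq, hqy⟩ := ih ⟨p, h', hpy⟩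
        exact ⟨q, List.mem_cons_of_mem _ hq, hqy⟩
    rw [slicePoints_cons] at hp
    cases hb : Nat.ble (listHead r) lo <;> rw [hb] at hp
    · exact Or.inr hp
    · exact (List.mem_cons.1 hp).imp (fun h => ⟨h, Nat.le_of_ble_eq_true hb⟩) id

lemma sweepSlabs_sound {B : ℕ} {check : List (ℕ × List ℕ) → List (List ℕ) → Bool}
    {fs : List (ℕ × List ℕ)} {ps : List (List ℕ)} {y : ℕ} {ys : List ℕ} (hB : y ≤ B)
    (hcheck : ∀ fs' ps', check fs' ps' = true → (∀ q ∈ fs', q.1 ≤ listDot q.2 ys) →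
      ∃ p ∈ ps', ListDominates p ys)
    (hfs : ∀ q ∈ fs, q.1 ≤ listDot q.2 (y :: ys)) (k lo : ℕ) (hlo : lo ≤ y)
    (h : sweepSlabs B check fs ps k lo = true) : ∃ p ∈ ps, ListDominates p (y :: ys) := by
  induction k generalizing lo with
  | zero => exact absurd h Bool.false_ne_true
  | succ k ih =>
    simp only [sweepSlabs_succ, Bool.or_eq_true, Bool.and_eq_true] at h
    rcases h with h | ⟨h₁, h₂⟩
    · have := Nat.le_of_ble_eq_true h
      omega
    · by_cases hy : nextBreak lo ps (B + 1) ≤ y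
      · exact ih _ hy h₂
      · exact exists_dominates_of_slicePoints hlo
          (hcheck _ _ h₁ (substIneqs_sound (by omega) hfs))

lemma coverTest_sound {B : ℕ} (n : ℕ) {fs : List (ℕ × List ℕ)} {ps : List (List ℕ)}
    (h : coverTest B n fs ps = true) {y : List ℕ} (hlen : y.length = n + 1)
    (hB : ∀ x ∈ y, x ≤ B) (hfs : ∀ q ∈ fs, q.1 ≤ listDot q.2 y) :
    ∃ p ∈ ps, ListDominates p y := by
  induction n generalizing fs ps y with
  | zero =>
    obtain ⟨x, rfl⟩ := List.length_eq_one_iff.1 hlen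
    have hx : x ≤ B := hB x (by simp)
    suffices hm : minHead ps (B + 1) ≤ x by
      obtain hx' | ⟨p, hp, hpx⟩ := exists_listHead_le_of_minHead_le hm
      · omega
      · exact ⟨p, hp, hpx, trivial⟩
    simp only [coverTest_zero, Bool.or_eq_true] at h
    rcases h with h | h
    · have := Nat.eq_of_beq_eq_true h
      omega
    · obtain ⟨q, hq, hlt⟩ := exists_lt_of_someIneqFails h
      by_contra hcon
      have h₁ := hfs q hq
      have h₂ : listHead q.2 * x ≤ listHead q.2 * (minHead ps (B + 1) - 1) :=
        Nat.mul_le_mul_left _ (by omega)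
      simp only [listDot] at h₁
      omega
  | succ n ih =>
    obtain _ | ⟨x, ys⟩ := y
    · simp at hlen
    · rw [coverTest_succ] at h
      refine sweepSlabs_sound (hB x (by simp)) (fun fs' ps' hc hq => ?_) hfs _ 0 (Nat.zero_le _) h
      exact ih hc (by simpa using hlen) (fun z hz => hB z (by simp [hz])) hq

/-! ### The slices of the cone -/

/-- The last five coordinates of `a z₆ + b z₇ + c z₈ + d z₉ + e z₁₀ + f z₁₂'' + j z₁₁''`. -/
def combTail (a b c d e f j : ℕ) : List ℕ :=
  [2 * b + c + d + 2 * e - j, 2 * a + 2 * c + d + e + 3 * f + 2 * j,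
    a + 2 * b + 2 * d + e - j, a + b + 2 * c + 2 * e - j, 2 * a + b + c + 2 * d + 3 * f + 2 * j]

/-- The combinations with `a + b + c + d + e + f = t` which are not obviously redundant. -/
def combTails (t : ℕ) : List (List ℕ) :=
  (List.range (t + 1)).flatMap fun a => (List.range (t - a + 1)).flatMap fun b =>
  (List.range (t - a - b + 1)).flatMap fun c => (List.range (t - a - b - c + 1)).flatMap fun d =>
  (List.range (t - a - b - c - d + 1)).flatMap fun e => (List.range 3).flatMap fun j =>
    let f := t - a - b - c - d - e
    bif Nat.ble j (2 * b + c + d + 2 * e) && Nat.ble j (a + 2 * b + 2 * d + e) &&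
        Nat.ble j (a + b + 2 * c + 2 * e) &&
        (Nat.beq j 0 || Nat.beq (a * b + a * e + b * c + b * e + c * d + d * e) 0) &&
        (Nat.ble j 1 || Nat.beq (b + e + f) 0) && (Nat.ble c 1 || Nat.ble d 1)
    then [combTail a b c d e f j] else []

/-- Valid inequalities `d x₀ ≤ f ⬝ (x₁, …, x₅)` of the cone. -/
def coneIneqs : List (ℕ × List ℕ) :=
  [(15, [3, 0, 1, 4, 5]), (15, [3, 5, 4, 1, 0]), (12, [0, 0, 2, 5, 4]), (12, [0, 4, 5, 2, 0]),
    (9, [0, 1, 2, 3, 2]), (9, [0, 2, 3, 2, 1]), (9, [2, 0, 1, 2, 3]), (9, [2, 3, 2, 1, 0]),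
    (8, [2, 0, 0, 2, 3]), (8, [2, 3, 2, 0, 0]), (8, [3, 2, 0, 0, 2]), (7, [2, 1, 0, 1, 2]),
    (7, [2, 2, 1, 0, 1]), (6, [2, 0, 1, 1, 2]), (6, [2, 2, 1, 1, 0]), (5, [3, 0, 1, 0, 2]),
    (5, [3, 2, 0, 1, 0]), (3, [0, 0, 1, 1, 1]), (3, [0, 1, 1, 1, 0]), (3, [1, 0, 0, 1, 1]),
    (3, [1, 1, 1, 0, 0]), (2, [0, 0, 0, 1, 1]), (2, [0, 1, 1, 0, 0]), (2, [1, 0, 0, 0, 1]),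
    (2, [1, 1, 0, 0, 0]), (1, [0, 0, 1, 0, 1]), (1, [0, 1, 0, 0, 1]), (1, [0, 1, 0, 1, 0])]

/-- A test that the slice `x₀ = t` of the cone is covered by the combinations of `combTails t`. -/
def sliceTest (t : ℕ) : Bool :=
  coverTest 12 4 (coneIneqs.map fun q => (q.1 * t, q.2)) (combTails t)

lemma sliceTest_eq_true {t : ℕ} (h₁ : 1 ≤ t) (h₄ : t ≤ 4) : sliceTest t = true := by
  interval_cases t <;> decide +kernel

lemma exists_of_mem_combTails {t : ℕ} {p : List ℕ} (hp : p ∈ combTails t) :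
    ∃ a b c d e f j : ℕ, a + b + c + d + e + f = t ∧ p = combTail a b c d e f j := by
  simp only [combTails, List.mem_flatMap, List.mem_range] at hp
  obtain ⟨a, ha, b, hb, c, hc, d, hd, e, he, j, -, hp⟩ := hp
  refine ⟨a, b, c, d, e, t - a - b - c - d - e, j, by omega, ?_⟩
  rw [cond_eq_ite] at hp
  split_ifs at hp
  · exact List.mem_singleton.1 hp
  · exact absurd hp List.not_mem_nil

/-! ### Generalities on cones -/

lemma toR_sub {d : ℕ} (x y : Fin d → ℤ) : toR (x - y) = toR x - toR y := by
  ext k; simp [toR]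

lemma toR_mem_coneFin {d n : ℕ} (v : Fin n → Fin d → ℤ) (i : Fin n) : toR (v i) ∈ coneFin v := by
  refine ⟨Pi.single i 1, fun j => ?_, ?_⟩
  · by_cases h : j = i
    · subst h; simp
    · simp [h]
  · rw [Finset.sum_eq_single i] <;> simp +contextual

/-- The lattice points of `coneFin v` form a submonoid. -/
def latticePoints {d n : ℕ} (v : Fin n → Fin d → ℤ) : AddSubmonoid (Fin d → ℤ) where
  carrier := {x | toR x ∈ coneFin v}
  zero_mem' := ⟨0, fun _ => le_rfl, by ext k; simp [toR]⟩
  add_mem' := by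
    rintro x y ⟨a, ha, hx⟩ ⟨b, hb, hy⟩
    refine ⟨a + b, fun i => add_nonneg (ha i) (hb i), ?_⟩
    rw [show toR (x + y) = toR x + toR y by ext k; simp [toR], hx, hy]
    simp [add_smul, Finset.sum_add_distrib]

lemma closure_range_le_latticePoints {d n : ℕ} (v : Fin n → Fin d → ℤ) :
    AddSubmonoid.closure (Set.range v) ≤ latticePoints v := by
  rw [AddSubmonoid.closure_le]
  rintro _ ⟨i, rfl⟩
  exact toR_mem_coneFin v i

/-- A linear form evaluated at a real combination of integer vectors. -/
lemma sum_mul_sum_smul_toR {d n : ℕ} (v : Fin n → Fin d → ℤ) (f : Fin d → ℤ) (a : Fin n → ℝ) :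
    ∑ k, (f k : ℝ) * (∑ i, a i • toR (v i)) k = ∑ i, a i * ((f ⬝ᵥ v i : ℤ) : ℝ) := by
  simp only [Finset.sum_apply, Pi.smul_apply, smul_eq_mul, toR, dotProduct, Finset.mul_sum,
    Int.cast_sum, Int.cast_mul]
  rw [Finset.sum_comm]
  exact Finset.sum_congr rfl fun i _ => Finset.sum_congr rfl fun k _ => by ring

lemma dotProduct_nonneg_of_mem_coneFin {d n : ℕ} {v : Fin n → Fin d → ℤ} {f : Fin d → ℤ}
    (hf : ∀ i, 0 ≤ f ⬝ᵥ v i) {x : Fin d → ℤ} (hx : toR x ∈ coneFin v) : 0 ≤ f ⬝ᵥ x := by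
  obtain ⟨a, ha, hx⟩ := hx
  have h := sum_mul_sum_smul_toR v f a
  rw [← hx] at h
  have h' : ((f ⬝ᵥ x : ℤ) : ℝ) = ∑ i, a i * ((f ⬝ᵥ v i : ℤ) : ℝ) := by
    rw [← h]; simp [dotProduct, toR]
  have : (0 : ℝ) ≤ ((f ⬝ᵥ x : ℤ) : ℝ) := by
    rw [h']
    exact Finset.sum_nonneg fun i _ => mul_nonneg (ha i) (by exact_mod_cast hf i)
  exact_mod_cast this

lemma pointedSet_coneFin {d n : ℕ} {v : Fin n → Fin d → ℤ} {g : Fin d → ℤ}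
    (hg : ∀ i, 0 < g ⬝ᵥ v i) : PointedSet (coneFin v) := by
  rintro x ⟨a, ha, rfl⟩ ⟨b, hb, hx⟩
  have h := sum_mul_sum_smul_toR v g (a + b)
  have h₀ : ∑ i, (a + b) i • toR (v i) = 0 := by
    simp only [Pi.add_apply, add_smul, Finset.sum_add_distrib]
    rw [← hx]; simp
  rw [h₀] at h
  simp only [Pi.zero_apply, mul_zero, Finset.sum_const_zero] at h
  have hpos : ∀ i, (0 : ℝ) < ((g ⬝ᵥ v i : ℤ) : ℝ) := fun i => by exact_mod_cast hg i
  have hz := (Finset.sum_eq_zero_iff_of_nonneg fun i _ =>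
    mul_nonneg (add_nonneg (ha i) (hb i)) (hpos i).le).1 h.symm
  refine Finset.sum_eq_zero fun i hi => ?_
  have : a i + b i = 0 := (mul_eq_zero.1 (hz i hi)).resolve_right (hpos i).ne'
  rw [show a i = 0 by linarith [ha i, hb i], zero_smul]

/-- An irreducible lattice point lying in the monoid generated by `v` is one of the generators. -/
lemma mem_range_of_mem_hilbC_of_mem_closure {d n : ℕ} {v : Fin n → Fin d → ℤ} {x : Fin d → ℤ}
    (hx : x ∈ hilbC (coneFin v)) (hxv : x ∈ AddSubmonoid.closure (Set.range v)) :
    x ∈ Set.range v := by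
  induction hxv using AddSubmonoid.closure_induction with
  | mem x h => exact h
  | zero => exact absurd rfl hx.2.1
  | add x y hxv hyv ihx ihy =>
    have hx' : toR x ∈ coneFin v := closure_range_le_latticePoints v hxv
    have hy' : toR y ∈ coneFin v := closure_range_le_latticePoints v hyv
    rcases eq_or_ne x 0 with rfl | hx0
    · rw [zero_add] at hx ⊢; exact ihy hx
    rcases eq_or_ne y 0 with rfl | hy0
    · rw [add_zero] at hx ⊢; exact ihx hx
    exact absurd ⟨x, y, hx', hy', hx0, hy0, rfl⟩ hx.2.2

lemma exists_eq_add_of_mem_closure_range {M ι : Type*} [AddCommMonoid M] {v : ι → M} {u : M}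
    (hu : u ∈ AddSubmonoid.closure (Set.range v)) (hu0 : u ≠ 0) :
    ∃ i, ∃ m ∈ AddSubmonoid.closure (Set.range v), u = v i + m := by
  induction hu using AddSubmonoid.closure_induction with
  | mem x h =>
    obtain ⟨i, rfl⟩ := h
    exact ⟨i, 0, zero_mem _, (add_zero _).symm⟩
  | zero => exact absurd rfl hu0
  | add x y hx hy ihx ihy =>
    rcases eq_or_ne x 0 with rfl | hx0
    · simpa using ihy (by simpa using hu0)
    · obtain ⟨i, m, hm, rfl⟩ := ihx hx0
      exact ⟨i, m + y, add_mem hm hy, add_assoc _ _ _⟩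

/-- In a cone with a positive grading, the Hilbert basis generates all lattice points. -/
lemma latticePoints_le_closure {d n : ℕ} {v : Fin n → Fin d → ℤ} {g : Fin d → ℤ}
    (hg : ∀ i, 0 < g ⬝ᵥ v i) : latticePoints v ≤ AddSubmonoid.closure (hilbC (coneFin v)) := by
  have hpos : ∀ x : Fin d → ℤ, toR x ∈ coneFin v → x ≠ 0 → 0 < g ⬝ᵥ x := by
    intro x hx hx0
    refine lt_of_le_of_ne (dotProduct_nonneg_of_mem_coneFin (fun i => (hg i).le) hx) fun h => hx0 ?_
    obtain ⟨a, ha, hxa⟩ := hx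
    have hs := sum_mul_sum_smul_toR v g a
    rw [← hxa, show ∑ k, (g k : ℝ) * toR x k = ((g ⬝ᵥ x : ℤ) : ℝ) by simp [dotProduct, toR], ← h,
      Int.cast_zero] at hs
    have hposR : ∀ i, (0 : ℝ) < ((g ⬝ᵥ v i : ℤ) : ℝ) := fun i => by exact_mod_cast hg i
    have hz := (Finset.sum_eq_zero_iff_of_nonneg fun i _ =>
      mul_nonneg (ha i) (hposR i).le).1 hs.symm
    have hx0 : toR x = 0 := hxa.trans <| Finset.sum_eq_zero fun i hi => by
      rw [(mul_eq_zero.1 (hz i hi)).resolve_right (hposR i).ne', zero_smul]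
    ext k
    simpa [toR] using congrFun hx0 k
  suffices h : ∀ (m : ℕ) (x : Fin d → ℤ), g ⬝ᵥ x ≤ m → toR x ∈ coneFin v →
      x ∈ AddSubmonoid.closure (hilbC (coneFin v)) from
    fun x hx => h (g ⬝ᵥ x).toNat x (Int.self_le_toNat _) hx
  intro m
  induction m with
  | zero =>
    intro x hxm hx
    rcases eq_or_ne x 0 with rfl | hx0
    · exact zero_mem _
    · have := hpos x hx hx0
      push_cast at hxm
      omega
  | succ m ih =>
    intro x hxm hx
    rcases eq_or_ne x 0 with rfl | hx0
    · exact zero_mem _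
    by_cases hirr : x ∈ hilbC (coneFin v)
    · exact AddSubmonoid.subset_closure hirr
    · obtain ⟨y, z, hy, hz, hy0, hz0, rfl⟩ : ∃ y z : Fin d → ℤ, toR y ∈ coneFin v ∧
          toR z ∈ coneFin v ∧ y ≠ 0 ∧ z ≠ 0 ∧ x = y + z := by
        by_contra hcon
        exact hirr ⟨hx, hx0, hcon⟩
      have hy' := hpos y hy hy0
      have hz' := hpos z hz hz0
      rw [dotProduct_add] at hxm
      push_cast at hxm
      exact add_mem (ih y (by omega) hy) (ih z (by omega) hz)

/-- The coefficients representing an irreducible lattice point other than a generator are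
less than `1`. -/
lemma coeff_lt_one_of_mem_hilbC {d n : ℕ} {v : Fin n → Fin d → ℤ} (hv : ∀ i, v i ≠ 0)
    {x : Fin d → ℤ} (hx : x ∈ hilbC (coneFin v)) (hxv : x ∉ Set.range v) {a : Fin n → ℝ}
    (ha : ∀ i, 0 ≤ a i) (hxa : toR x = ∑ i, a i • toR (v i)) (i : Fin n) : a i < 1 := by
  by_contra! hi
  refine hx.2.2 ⟨v i, x - v i, toR_mem_coneFin v i, ⟨a - Pi.single i 1, fun j => ?_, ?_⟩, hv i,
    sub_ne_zero.2 fun h => hxv ⟨i, h.symm⟩, by simp⟩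
  · by_cases h : j = i
    · subst h; simpa using hi
    · simpa [h] using ha j
  · have hs : ∑ j, (Pi.single i (1 : ℝ) : Fin n → ℝ) j • toR (v j) = toR (v i) := by
      rw [Finset.sum_eq_single i] <;> simp +contextual
    simp only [Pi.sub_apply, sub_smul, Finset.sum_sub_distrib, hs]
    rw [toR_sub, hxa]

/-! ### The Hilbert basis of the cone -/

/-- The relation `z₆ + z₇ + z₁₀ + z₁₂'' = 2 (z₈ + z₉)` allows to eliminate `z₈` or `z₉`. -/
lemma exists_coeff_eq_zero {x : Fin 6 → ℝ} (hx : x ∈ coneFin w) :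
    ∃ a : Fin 12 → ℝ, (∀ i, 0 ≤ a i) ∧ x = ∑ i, a i • toR (w i) ∧ (a 7 = 0 ∨ a 8 = 0) := by
  obtain ⟨a, ha, rfl⟩ := hx
  set s := min (a 7) (a 8) with hs
  have hs0 : 0 ≤ s := le_min (ha 7) (ha 8)
  refine ⟨a + (s / 2) • ![0, 0, 0, 0, 0, 1, 1, -2, -2, 1, 0, 1], fun i => ?_, ?_, ?_⟩
  · have h7 : s ≤ a 7 := min_le_left _ _
    have h8 : s ≤ a 8 := min_le_right _ _
    have := ha i
    fin_cases i <;> simp at this ⊢ <;> linarith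
  · ext k
    fin_cases k <;> simp [Fin.sum_univ_succ, w, toR] <;> ring
  · rcases min_choice (a 7) (a 8) with h | h
    · left; simp [hs, h]
    · right; simp [hs, h]

/-- The linear form that is nonnegative on the cone by an inequality of `coneIneqs`. -/
def ineqForm (q : ℕ × List ℕ) : Fin 6 → ℤ :=
  Matrix.vecCons (-(q.1 : ℤ)) fun k => ((q.2.getD k 0 : ℕ) : ℤ)

lemma le_listDot_of_ineqForm_nonneg {q : ℕ × List ℕ} {x : Fin 6 → ℕ}
    (h : 0 ≤ ineqForm q ⬝ᵥ fun k => (x k : ℤ)) :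
    q.1 * x 0 ≤ listDot q.2 [x 1, x 2, x 3, x 4, x 5] := by
  zify
  obtain ⟨d, _ | ⟨a, _ | ⟨b, _ | ⟨c, _ | ⟨e, _ | ⟨f, l⟩⟩⟩⟩⟩⟩ := q <;>
    simp [ineqForm, dotProduct, Fin.sum_univ_succ, listDot, listHead, listTail] at h ⊢ <;>
    linarith

lemma ineqForm_nonneg : ∀ q ∈ coneIneqs, ∀ i, 0 ≤ ineqForm q ⬝ᵥ w i := by
  decide +kernel

lemma coord_nonneg : ∀ k ∈ ({0, 2, 5} : Finset (Fin 6)), ∀ i, 0 ≤ Pi.single k 1 ⬝ᵥ w i := by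
  decide +kernel

lemma eq_of_sub_mem_coneFin {i j : Fin 12} (h : toR (w i - w j) ∈ coneFin w) : i = j := by
  have hsep : ∀ i j : Fin 12, i ≠ j →
      (∃ q ∈ coneIneqs, ineqForm q ⬝ᵥ (w i - w j) < 0) ∨
        ∃ k ∈ ({0, 2, 5} : Finset (Fin 6)), Pi.single k 1 ⬝ᵥ (w i - w j) < 0 := by
    decide +kernel
  by_contra hij
  rcases hsep i j hij with ⟨q, hq, hlt⟩ | ⟨k, hk, hlt⟩
  · exact absurd (dotProduct_nonneg_of_mem_coneFin (ineqForm_nonneg q hq) h) (not_le.2 hlt)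
  · exact absurd (dotProduct_nonneg_of_mem_coneFin (coord_nonneg k hk) h) (not_le.2 hlt)

lemma sum_nsmul_mem_closure (c : Fin 12 → ℕ) :
    ∑ i, c i • w i ∈ AddSubmonoid.closure (Set.range w) :=
  sum_mem fun i _ => nsmul_mem (AddSubmonoid.subset_closure (Set.mem_range_self i)) _

lemma mem_closure_of_ineqs {t : ℕ} (ht : t ≤ 4) {y : Fin 5 → ℕ} (hy : ∀ k, y k ≤ 12)
    (h : ∀ q ∈ coneIneqs, q.1 * t ≤ listDot q.2 [y 0, y 1, y 2, y 3, y 4]) :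
    (![t, y 0, y 1, y 2, y 3, y 4] : Fin 6 → ℤ) ∈ AddSubmonoid.closure (Set.range w) := by
  rcases Nat.eq_zero_or_pos t with rfl | ht0
  · convert sum_nsmul_mem_closure ![y 0, y 1, y 2, y 3, y 4, 0, 0, 0, 0, 0, 0, 0] using 1
    ext k
    fin_cases k <;> simp [Fin.sum_univ_succ, w]
  obtain ⟨p, hp, hpy⟩ := coverTest_sound 4 (sliceTest_eq_true ht0 ht)
    (y := [y 0, y 1, y 2, y 3, y 4]) rfl (by simp [hy]) (by
      intro q hq
      obtain ⟨r, hr, rfl⟩ := List.mem_map.1 hq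
      exact h r hr)
  obtain ⟨a, b, c, d, e, f, j, rfl, rfl⟩ := exists_of_mem_combTails hp
  obtain ⟨h0, h1, h2, h3, h4, -⟩ := hpy
  change 2 * b + c + d + 2 * e - j ≤ y 0 at h0
  change 2 * a + 2 * c + d + e + 3 * f + 2 * j ≤ y 1 at h1
  change a + 2 * b + 2 * d + e - j ≤ y 2 at h2
  change a + b + 2 * c + 2 * e - j ≤ y 3 at h3
  change 2 * a + b + c + 2 * d + 3 * f + 2 * j ≤ y 4 at h4
  convert sum_nsmul_mem_closure ![y 0 + j - (2 * b + c + d + 2 * e),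
    y 1 - (2 * a + 2 * c + d + e + 3 * f + 2 * j), y 2 + j - (a + 2 * b + 2 * d + e),
    y 3 + j - (a + b + 2 * c + 2 * e), y 4 - (2 * a + b + c + 2 * d + 3 * f + 2 * j),
    a, b, c, d, e, j, f] using 1
  ext k
  fin_cases k <;> simp [Fin.sum_univ_succ, w] <;> omega

lemma hilbC_subset_range : hilbC (coneFin w) ⊆ Set.range w := by
  intro x hx
  by_contra hxw
  obtain ⟨a, ha, hxa, h78⟩ := exists_coeff_eq_zero hx.1
  have hlt := coeff_lt_one_of_mem_hilbC (v := w) (by decide) hx hxw ha hxa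
  have hcoord : ∀ k, (x k : ℝ) = ∑ i, a i * (w i k : ℝ) := fun k => by
    simpa [toR] using congrFun hxa k
  obtain ⟨h0, h1, h2, h3, h4, h5⟩ : (0 ≤ x 0 ∧ x 0 ≤ 4) ∧ (0 ≤ x 1 ∧ x 1 ≤ 12) ∧
      (0 ≤ x 2 ∧ x 2 ≤ 12) ∧ (0 ≤ x 3 ∧ x 3 ≤ 12) ∧ (0 ≤ x 4 ∧ x 4 ≤ 12) ∧
      (0 ≤ x 5 ∧ x 5 ≤ 12) := by
    suffices h : ∀ (k : Fin 6) (B : ℤ), (-1 : ℝ) < x k → (x k : ℝ) < (B + 1 : ℤ) →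
        0 ≤ x k ∧ x k ≤ B by
      simp only [Fin.forall_fin_succ, IsEmpty.forall_iff, and_true] at ha hlt
      refine ⟨h _ _ ?_ ?_, h _ _ ?_ ?_, h _ _ ?_ ?_, h _ _ ?_ ?_, h _ _ ?_ ?_, h _ _ ?_ ?_⟩ <;>
        rw [hcoord] <;> simp [Fin.sum_univ_succ, w] at ha hlt ⊢ <;>
        rcases h78 with h78 | h78 <;> linarith
    intro k B hl hu
    have hl' : -1 < x k := by exact_mod_cast hl
    have hu' : x k < B + 1 := by exact_mod_cast hu
    omega
  lift x to Fin 6 → ℕ using fun k => by fin_cases k <;> simp <;> omega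
  simp only [Nat.cast_nonneg, true_and] at h0 h1 h2 h3 h4 h5
  refine hxw (mem_range_of_mem_hilbC_of_mem_closure hx ?_)
  convert mem_closure_of_ineqs (t := x 0) (y := fun k => x k.succ) (by omega) ?_ fun q hq =>
    le_listDot_of_ineqForm_nonneg
      (dotProduct_nonneg_of_mem_coneFin (ineqForm_nonneg q hq) hx.1) using 1
  · ext k
    fin_cases k <;> rfl
  · intro k
    fin_cases k <;> simp <;> omega

/-- `C₁₂'` is a pointed full-dimensional rational cone whose Hilbert basis is
exactly `{z₁, …, z₁₀, z₁₁'', z₁₂''}`. -/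
theorem C12'_hilbert_basis :
    PointedSet (coneFin w) ∧ FullDim (coneFin w) ∧
    hilbC (coneFin w) = Set.range w := by
  have hg : ∀ i, 0 < ![0, 1, 2, 1, 1, 2] ⬝ᵥ w i := by decide +kernel
  have hpt := pointedSet_coneFin hg
  refine ⟨hpt, ?_, hilbC_subset_range.antisymm ?_⟩
  · refine eq_top_iff.2 fun x _ => ?_
    have hmem : ∀ i, toR (w i) ∈ Submodule.span ℝ (coneFin w) :=
      fun i => Submodule.subset_span (toR_mem_coneFin w i)
    rw [show x = ∑ i, ![x 1, x 2 - x 0 * 2, x 3 - x 0, x 4 - x 0, x 5 - x 0 * 2, x 0,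
      0, 0, 0, 0, 0, 0] i • toR (w i) by
        ext k; fin_cases k <;> simp [Fin.sum_univ_succ, w, toR]]
    exact sum_mem fun i _ => Submodule.smul_mem _ _ (hmem i)
  · rintro _ ⟨i, rfl⟩
    refine ⟨toR_mem_coneFin w i, (by decide : ∀ i, w i ≠ 0) i, ?_⟩
    rintro ⟨u, v, hu, hv, hu0, hv0, huv⟩
    obtain ⟨j, m, hm, rfl⟩ := exists_eq_add_of_mem_closure_range
      (AddSubmonoid.closure_mono hilbC_subset_range (latticePoints_le_closure hg hu)) hu0
    have hm' : m ∈ latticePoints w := closure_range_le_latticePoints w hm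
    obtain rfl : i = j := eq_of_sub_mem_coneFin <| by
      rw [huv, add_assoc, add_sub_cancel_left]
      exact add_mem hm' hv
    have hvm : -v = m := by
      rw [add_assoc, left_eq_add] at huv
      exact neg_eq_of_add_eq_zero_left huv
    have hv0' := hpt _ hv (by
      rw [show -toR v = toR m by rw [← hvm]; ext k; simp [toR]]
      exact hm')
    exact hv0 (by ext k; simpa [toR] using congrFun hv0' k)
end

section
/- Let $C_{12}'\subseteq\mathbb{R}^6$ be the cone generated by $z_1=(0,1,0,0,0,0)$, $z_2=(0,0,1,0,0,0)$, $z_3=(0,0,0,1,0,0)$, $z_4=(0,0,0,0,1,0)$, $z_5=(0,0,0,0,0,1)$, $z_6=(1,0,2,1,1,2)$, $z_7=(1,2,0,2,1,1)$, $z_8=(1,1,2,0,2,1)$, $z_9=(1,1,1,2,0,2)$, $z_{10}=(1,2,1,1,2,0)$, $z_{11}''=(0,-1,2,-1,-1,2)$, $z_{12}''=(1,0,3,0,0,3)$. Then $C_{12}'$ fails (UHC): there exists a point $x\in C_{12}'$ that lies in no cone generated by six of these twelve vectors forming a $\mathbb{Z}$-basis of $\mathbb{Z}^6$. -/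
/-- A test that each sublist of length `r` of `l` is contained in one of the sets of naturals
whose binary masks are listed in `L`. -/
def sublistsCovered : List ℕ → ℕ → List ℕ → Bool
  | _, 0, L => !L.isEmpty
  | [], _ + 1, _ => true
  | a :: l, r + 1, L =>
    sublistsCovered l (r + 1) L && sublistsCovered l r (L.filter fun m => m.testBit a)

theorem exists_mask_of_sublistsCovered {l t : List ℕ} (h : t.Sublist l) :
    ∀ {L : List ℕ}, sublistsCovered l t.length L = true →
      ∃ m ∈ L, ∀ i ∈ t, m.testBit i = true := by
  induction h with
  | slnil =>
    intro L hL
    cases L with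
    | nil => simp [sublistsCovered] at hL
    | cons m L => exact ⟨m, by simp⟩
  | @cons t l a h ih =>
    intro L hL
    cases t with
    | nil => exact ih (by simpa [sublistsCovered] using hL)
    | cons b t =>
      rw [List.length_cons, sublistsCovered, Bool.and_eq_true] at hL
      exact ih hL.1
  | @cons_cons t l a h ih =>
    intro L hL
    rw [List.length_cons, sublistsCovered, Bool.and_eq_true] at hL
    obtain ⟨m, hm, ht⟩ := ih hL.2
    rw [List.mem_filter] at hm
    exact ⟨m, hm.1, by simpa using ⟨hm.2, ht⟩⟩

/-- A linear form that is nonnegative on a family of vectors is nonnegative on its cone. -/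
theorem nonneg_of_mem_coneFin {d n : ℕ} {v : Fin n → (Fin d → ℤ)} {f x : Fin d → ℤ}
    (hf : ∀ k, 0 ≤ f ⬝ᵥ v k) (hx : toR x ∈ coneFin v) : 0 ≤ f ⬝ᵥ x := by
  obtain ⟨a, ha, hxa⟩ := hx
  have hcast (z : Fin d → ℤ) : ((f ⬝ᵥ z : ℤ) : ℝ) = toR f ⬝ᵥ toR z := by
    simp [dotProduct, toR]
  have : (0 : ℝ) ≤ ((f ⬝ᵥ x : ℤ) : ℝ) := by
    rw [hcast, hxa, dotProduct_sum]
    refine Finset.sum_nonneg fun k _ => ?_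
    rw [dotProduct_smul, ← hcast]
    exact mul_nonneg (ha k) (by exact_mod_cast hf k)
  exact_mod_cast this

/-- A linear form whose values on a generating family of `ℤ^d` are divisible by `p`
has all its coefficients divisible by `p`. -/
theorem dvd_of_closure_range_eq_top {d n : ℕ} {v : Fin n → (Fin d → ℤ)} {g : Fin d → ℤ}
    {p : ℤ}
    (hg : ∀ k, p ∣ g ⬝ᵥ v k) (hv : AddSubgroup.closure (Set.range v) = ⊤) (j : Fin d) :
    p ∣ g j := by
  have key : ∀ z ∈ AddSubgroup.closure (Set.range v), p ∣ g ⬝ᵥ z := by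
    intro z hz
    induction hz using AddSubgroup.closure_induction with
    | mem z hz => obtain ⟨k, rfl⟩ := hz; exact hg k
    | zero => simp
    | add y z _ _ hy hz => rw [dotProduct_add]; exact dvd_add hy hz
    | neg z _ hz => rw [dotProduct_neg]; exact hz.neg_right
  simpa using key (Pi.single j 1) (hv ▸ AddSubgroup.mem_top _)

/-- A point of `C₁₂'` outside all its unimodular subcones. -/
def uncoveredPoint : Fin 6 → ℤ := ![13, 12, 24, 11, 14, 26]

/-- Linear forms negative at `uncoveredPoint`, each with a mask of generators on which it is
nonnegative. -/
def separatingForms : List ((Fin 6 → ℤ) × ℕ) :=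
  [ (![4, 0, 1, 0, -2, -2], 4071),
    (![-3, 0, 1, 0, 1, 0], 3775),
    (![-3, 0, 0, 1, 0, 1], 3455),
    (![-2, 0, 0, 1, 1, 0], 1023),
    (![-6, 0, 4, 3, 0, -2], 4015),
    (![0, 2, 0, -1, -1, 0], 4051),
    (![-11, 1, 3, 4, 1, 0], 1919),
    (![7, -2, -3, -2, 0, 1], 3576),
    (![-4, 2, 1, 0, 0, 0], 1759),
    (![9, -2, -3, -2, 0, 0], 3064),
    (![3, 1, -2, -3, 0, 1], 3801),
    (![9, -5, -3, 0, 1, 0], 2556),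
    (![7, -5, -2, 0, 1, 0], 3516),
    (![12, -5, -2, 0, 0, -2], 3052) ]

/-- Linear forms and moduli, each with a mask of generators on which the form vanishes modulo the
modulus. -/
def modularForms : List ((Fin 6 → ℤ) × ℕ × ℕ) :=
  [ (![1, 1, 1, 0, 1, 0], 2, 3828),
    (![1, 0, 0, 1, 0, 1], 2, 2795),
    (![0, 1, 0, 0, 0, 0], 2, 2686),
    (![0, 0, 0, 1, 0, 0], 2, 2523),
    (![1, 1, 0, 0, 1, 0], 2, 1526),
    (![1, 1, 0, 1, 0, 1], 2, 3946),
    (![1, 0, 0, 0, 0, 1], 2, 3279),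
    (![1, 0, 1, 0, 0, 0], 2, 3869),
    (![0, 0, 0, 1, 1, 0], 2, 3507),
    (![0, 0, 0, 0, 1, 0], 2, 2967),
    (![1, 0, 1, 0, 1, 0], 2, 2933),
    (![1, 0, 1, 0, 0, 1], 2, 1997),
    (![1, 1, 0, 1, 0, 0], 2, 1978),
    (![0, 0, 1, 0, 0, 0], 2, 1277),
    (![0, 1, 1, 2, 2, 0], 3, 3888),
    (![0, 1, 1, 0, 0, 1], 3, 3660),
    (![0, 0, 1, 2, 0, 2], 3, 2889),
    (![0, 1, 0, 2, 3, 0], 5, 2866),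
    (![0, 1, 0, 1, 0, 0], 3, 2842),
    (![1, 0, 4, 0, 0, 4], 5, 2637),
    (![0, 1, 0, 3, 2, 0], 5, 2290),
    (![0, 0, 1, 2, 2, 0], 3, 2289),
    (![0, 1, 0, 0, 1, 0], 3, 2262),
    (![1, 0, 3, 0, 4, 0], 5, 2261),
    (![1, 1, 1, 0, 1, 0], 3, 1940),
    (![1, 1, 1, 2, 0, 2], 3, 1768),
    (![1, 1, 0, 1, 0, 1], 3, 1482),
    (![1, 0, 1, 2, 0, 0], 3, 1433),
    (![1, 0, 4, 0, 3, 0], 5, 1429),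
    (![0, 1, 0, 2, 0, 4], 5, 1258) ]

theorem separatingForms_spec : ∀ c ∈ separatingForms, c.1 ⬝ᵥ uncoveredPoint < 0 ∧
    ∀ i : Fin 12, c.2.testBit i = true → 0 ≤ c.1 ⬝ᵥ w i := by
  decide +kernel

theorem modularForms_spec : ∀ c ∈ modularForms, (∃ j, ¬ (c.2.1 : ℤ) ∣ c.1 j) ∧
    ∀ i : Fin 12, c.2.2.testBit i = true → (c.2.1 : ℤ) ∣ c.1 ⬝ᵥ w i := by
  decide +kernel

theorem sublistsCovered_masks : sublistsCovered (List.range 12) 6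
    (separatingForms.map Prod.snd ++ modularForms.map fun c => c.2.2) = true := by
  decide +kernel

theorem exists_mask_of_injective {σ : Fin 6 → Fin 12} (hσ : Function.Injective σ) :
    ∃ m ∈ separatingForms.map Prod.snd ++ modularForms.map fun c => c.2.2,
      ∀ k, m.testBit (σ k) = true := by
  let S : Finset ℕ := Finset.univ.image fun k => (σ k : ℕ)
  have hS : S.card = 6 := by
    have hval : Function.Injective fun k => (σ k : ℕ) := Fin.val_injective.comp hσ
    rw [Finset.card_image_of_injective _ hval, Finset.card_fin]
  have hlen : ((List.range 12).filter (· ∈ S)).length = 6 := by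
    rw [← List.toFinset_card_of_nodup (List.nodup_range.filter _), ← hS]
    congr 1
    ext n
    simp only [List.mem_toFinset, List.mem_filter, List.mem_range, decide_eq_true_eq,
      and_iff_right_iff_imp]
    intro hn
    obtain ⟨k, -, rfl⟩ := Finset.mem_image.mp hn
    exact (σ k).isLt
  obtain ⟨m, hm, hmS⟩ := exists_mask_of_sublistsCovered
    (List.filter_sublist (p := (· ∈ S)) (l := List.range 12)) (by rw [hlen]; exact sublistsCovered_masks)
  refine ⟨m, hm, fun k => hmS _ ?_⟩
  simp [S]

theorem uncoveredPoint_mem_coneFin : toR uncoveredPoint ∈ coneFin w := by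
  refine ⟨![2, 0, 0, 3, 0, 3, 4, 4, 2, 0, 4, 0], fun i => ?_, ?_⟩
  · fin_cases i <;> simp
  · ext j
    fin_cases j <;> simp [toR, uncoveredPoint, w, Fin.sum_univ_succ] <;> norm_num

/-- `C₁₂'` fails (UHC): some point of `C₁₂'` lies in no cone generated by six
of the twelve generators forming a `ℤ`-basis of `ℤ⁶`. -/
theorem C12'_fails_UHC :
    ∃ x ∈ coneFin w, ∀ y : Fin 6 → (Fin 6 → ℤ),
      (∀ k, ∃ i, y k = w i) →
      LinearIndependent ℤ y →
      AddSubgroup.closure (Set.range y) = ⊤ →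
      x ∉ coneFin y := by
  refine ⟨toR uncoveredPoint, uncoveredPoint_mem_coneFin, fun y hy hli hcl hx => ?_⟩
  choose σ hσ using hy
  have hinj : Function.Injective σ := fun k l hkl =>
    hli.injective (by rw [hσ k, hσ l, hkl])
  obtain ⟨m, hm, hmσ⟩ := exists_mask_of_injective hinj
  rw [List.mem_append, List.mem_map, List.mem_map] at hm
  rcases hm with ⟨c, hc, rfl⟩ | ⟨c, hc, rfl⟩
  · obtain ⟨hneg, hnn⟩ := separatingForms_spec c hc
    refine hneg.not_ge (nonneg_of_mem_coneFin (fun k => ?_) hx)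
    rw [hσ k]
    exact hnn _ (hmσ k)
  · obtain ⟨⟨j, hj⟩, hdvd⟩ := modularForms_spec c hc
    refine hj (dvd_of_closure_range_eq_top (fun k => ?_) hcl j)
    rw [hσ k]
    exact hdvd _ (hmσ k)
end

section
/- Let $M\subseteq\mathbb{Z}^d$ be a positive affine monoid. If $M$ satisfies (UHC), i.e., $M$ is the union of the submonoids generated by subsets of $\operatorname{Hilb}(M)$ that are $\mathbb{Z}$-bases of $\mathbb{Z}^d$, then $M=\mathbb{R}_+M\cap\mathbb{Z}^d$: every lattice point of the real cone generated by $M$ belongs to $M$. -/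
/-- The Hilbert basis of a positive affine monoid `M`: the nonzero elements of
`M` admitting no decomposition into a sum of two nonzero elements of `M`. -/
def hilbM {d : ℕ} (M : AddSubmonoid (Fin d → ℤ)) : Set (Fin d → ℤ) :=
  { z | z ∈ M ∧ z ≠ 0 ∧ ¬∃ u v : Fin d → ℤ, u ∈ M ∧ v ∈ M ∧ u ≠ 0 ∧ v ≠ 0 ∧ z = u + v }

/-- `M` satisfies the integral Carathéodory property: every element of `M` is a
nonnegative integral combination of at most `d` elements of `Hilb(M)`. -/
def ICPmonoid {d : ℕ} (M : AddSubmonoid (Fin d → ℤ)) : Prop :=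
  ∀ x ∈ M, ∃ (s : Finset (Fin d → ℤ)) (a : (Fin d → ℤ) → ℕ),
    (s : Set (Fin d → ℤ)) ⊆ hilbM M ∧ s.card ≤ d ∧ x = ∑ y ∈ s, a y • y

/-- A lattice point of the real cone generated by an additive submonoid `M` of `ℤ^d` has a positive
multiple in `M`. -/
theorem exists_pos_nsmul_mem_of_toR_mem_coneSet {d : ℕ} (M : AddSubmonoid (Fin d → ℤ))
    {v : Fin d → ℤ} (hv : toR v ∈ coneSet (M : Set (Fin d → ℤ))) :
    ∃ N : ℕ, 0 < N ∧ N • v ∈ M := by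
  obtain ⟨n, w, a, hw, ha, hva⟩ := hv
  let r : ℕ → Fin d → ℤ := fun m => m • v - ∑ i, ⌊(m : ℝ) * a i⌋₊ • w i
  let B : Fin d → ℤ := fun j => ∑ i, |w i j|
  have hr : ∀ m, r m ∈ Set.Icc (-B) B := by
    intro m
    suffices h : ∀ j, |r m j| ≤ B j from
      ⟨fun j => (abs_le.mp (h j)).1, fun j => (abs_le.mp (h j)).2⟩
    intro j
    have hvj : (v j : ℝ) = ∑ i, a i * (w i j : ℝ) := by
      simpa [toR] using congrFun hva j
    have hrj : (r m j : ℝ) = ∑ i, ((m : ℝ) * a i - ⌊(m : ℝ) * a i⌋₊) * (w i j : ℝ) := by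
      simp [r, hvj, Finset.sum_apply, sub_mul, Finset.sum_sub_distrib, Finset.mul_sum, mul_assoc]
    have habs : |(r m j : ℝ)| ≤ ∑ i, |(w i j : ℝ)| := by
      rw [hrj]
      refine (Finset.abs_sum_le_sum_abs _ _).trans (Finset.sum_le_sum fun i _ => ?_)
      rw [abs_mul]
      refine mul_le_of_le_one_left (abs_nonneg _) (abs_le.mpr ?_)
      have h₁ := Nat.floor_le (mul_nonneg m.cast_nonneg (ha i) : (0 : ℝ) ≤ m * a i)
      have h₂ := Nat.lt_floor_add_one ((m : ℝ) * a i)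
      constructor <;> linarith
    exact_mod_cast habs
  obtain ⟨p, -, q, -, hpq, hrpq⟩ := Set.infinite_univ.exists_lt_map_eq_of_mapsTo
    (fun m _ => hr m) (Set.finite_Icc (-B) B)
  have hle : ∀ i, ⌊(p : ℝ) * a i⌋₊ ≤ ⌊(q : ℝ) * a i⌋₊ := fun i =>
    Nat.floor_le_floor (mul_le_mul_of_nonneg_right (by exact_mod_cast hpq.le) (ha i))
  refine ⟨q - p, Nat.sub_pos_of_lt hpq, ?_⟩
  have hdiff : (q - p) • v = ∑ i, (⌊(q : ℝ) * a i⌋₊ - ⌊(p : ℝ) * a i⌋₊) • w i := by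
    rw [Finset.sum_congr rfl fun i _ => sub_nsmul (w i) (hle i), sub_nsmul v hpq.le]
    simp only [← sub_eq_add_neg, Finset.sum_sub_distrib]
    exact sub_eq_sub_iff_sub_eq_sub.mp hrpq.symm
  rw [hdiff]
  exact M.sum_mem fun i _ => M.nsmul_mem (hw i) _

/-- The submonoid generated by a `ℤ`-basis is closed under division by positive integers. -/
theorem mem_closure_range_of_nsmul_mem {ι G : Type*} [Fintype ι] [AddCommGroup G] {y : ι → G}
    (hli : LinearIndependent ℤ y) (hspan : AddSubgroup.closure (Set.range y) = ⊤)
    {N : ℕ} (hN : 0 < N) {v : G} (hv : N • v ∈ AddSubmonoid.closure (Set.range y)) :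
    v ∈ AddSubmonoid.closure (Set.range y) := by
  have hv' : v ∈ Submodule.span ℤ (Set.range y) := by
    rw [← Submodule.mem_toAddSubgroup, Submodule.span_int_eq_addSubgroupClosure, hspan]
    trivial
  obtain ⟨c, rfl⟩ := (Submodule.mem_span_range_iff_exists_fun ℤ).mp hv'
  rw [← Submodule.span_nat_eq_addSubmonoidClosure, Submodule.mem_toAddSubmonoid,
    Submodule.mem_span_range_iff_exists_fun] at hv
  obtain ⟨b, hb⟩ := hv
  have hcoef : ∀ k, (b k : ℤ) = N * c k := by
    refine fun k => congrFun (hli.fintypeLinearCombination_injective (a₁ := fun k => (b k : ℤ))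
      (a₂ := fun k => N * c k) ?_) k
    simpa [Fintype.linearCombination_apply, mul_smul, Finset.smul_sum] using hb
  refine AddSubmonoid.sum_mem _ fun k _ => ?_
  have hc : 0 ≤ c k :=
    nonneg_of_mul_nonneg_right ((hcoef k) ▸ Int.natCast_nonneg _) (by exact_mod_cast hN)
  lift c k to ℕ using hc with e
  rw [natCast_zsmul]
  exact AddSubmonoid.nsmul_mem _ (AddSubmonoid.subset_closure (Set.mem_range_self k)) e

/-- If a positive affine monoid `M ⊆ ℤ^d` is the union of the submonoids
generated by subsets of `Hilb(M)` that are `ℤ`-bases of `ℤ^d` (property (UHC)),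
then `M = ℝ₊M ∩ ℤ^d`. -/
theorem eq_lattice_points_of_UHC {d : ℕ} (M : AddSubmonoid (Fin d → ℤ))
    (hFG : M.FG) (hpos : ∀ x ∈ M, -x ∈ M → x = 0)
    (hUHC : ∀ x ∈ M, ∃ y : Fin d → (Fin d → ℤ),
      (∀ k, y k ∈ hilbM M) ∧ LinearIndependent ℤ y ∧
      AddSubgroup.closure (Set.range y) = ⊤ ∧
      x ∈ AddSubmonoid.closure (Set.range y)) :
    ∀ v : Fin d → ℤ, toR v ∈ coneSet (M : Set (Fin d → ℤ)) ↔ v ∈ M := by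
  refine fun v => ⟨fun hv => ?_, fun hv => ⟨1, fun _ => v, fun _ => 1, by simpa using hv, by simp,
    by simp⟩⟩
  obtain ⟨N, hN, hNv⟩ := exists_pos_nsmul_mem_of_toR_mem_coneSet M hv
  obtain ⟨y, hy, hli, hspan, hmem⟩ := hUHC _ hNv
  exact AddSubmonoid.closure_le.mpr (Set.range_subset_iff.mpr fun k => (hy k).1)
    (mem_closure_range_of_nsmul_mem hli hspan hN hmem)
end
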